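/- Let f : ℝ^n → ℝ be continuously differentiable with L-Lipschitz gradient, let P be a real n×m matrix each of whose columns has Euclidean norm at most 1, let ε > 0 and x ∈ ℝ^n, and let ∇_{P,ε}f(x) be the finite-difference subspace gradient. If ‖Pᵀ∇f(x)‖ ≥ 4 m² L ε, then ‖∇_{P,ε}f(x)‖ ≥ (1/2) ‖Pᵀ∇f(x)‖. Consequently, if moreover H is a symmetric m×m matrix with M₁ I_m ⪯ H (M₁ > 0), d = −H ∇_{P,ε}f(x), c ∈ (0,1), α > 0, and the approximate Armijo condition f(x + αPd) ≤ f(x) + cα (∇_{P,ε}f(x))ᵀ d holds, then f(x + αPd) − f(x) ≤ −(c α M₁ / 4) ‖Pᵀ∇f(x)‖². -/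

import Mathlib

open Matrix
open scoped RealInnerProductSpace

/-- The finite-difference subspace gradient: `(∇_{P,ε}f(x))_i = (f(x+εPe_i) - f(x-εPe_i))/(2ε)`. -/
noncomputable def fdGrad {n m : ℕ} (f : EuclideanSpace ℝ (Fin n) → ℝ)
    (P : Matrix (Fin n) (Fin m) ℝ) (ε : ℝ) (x : EuclideanSpace ℝ (Fin n)) :
    EuclideanSpace ℝ (Fin m) :=
  (EuclideanSpace.equiv (Fin m) ℝ).symm fun i =>
    (f (x + ε • Matrix.toEuclideanLin P (EuclideanSpace.single i (1 : ℝ))) -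
      f (x - ε • Matrix.toEuclideanLin P (EuclideanSpace.single i (1 : ℝ)))) / (2 * ε)

/-- The central difference of a function with `L`-Lipschitz gradient along a step `w` differs from
the directional derivative by at most `2 * L * ‖w‖ ^ 2`. -/
lemma abs_central_diff_sub_inner_gradient_le {E : Type*} [NormedAddCommGroup E]
    [InnerProductSpace ℝ E] [CompleteSpace E] {f : E → ℝ} {L : ℝ} (hL : 0 ≤ L)
    (hf : Differentiable ℝ f) (hlip : ∀ u v : E, ‖gradient f u - gradient f v‖ ≤ L * ‖u - v‖)
    (x w : E) :
    |f (x + w) - f (x - w) - 2 * ⟪gradient f x, w⟫| ≤ 2 * L * ‖w‖ ^ 2 := by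
  have hbound : ∀ y ∈ Metric.closedBall x ‖w‖,
      ‖InnerProductSpace.toDual ℝ E (gradient f y) -
        InnerProductSpace.toDual ℝ E (gradient f x)‖ ≤ L * ‖w‖ := by
    intro y hy
    rw [← map_sub, LinearIsometryEquiv.norm_map]
    exact (hlip y x).trans (mul_le_mul_of_nonneg_left (mem_closedBall_iff_norm.mp hy) hL)
  have h := (convex_closedBall x ‖w‖).norm_image_sub_le_of_norm_hasFDerivWithin_le'
    (fun y _ => (hf y).hasGradientAt.hasFDerivAt.hasFDerivWithinAt) hbound
    (x := x - w) (y := x + w) (by simp) (by simp)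
  have hw : x + w - (x - w) = (2 : ℝ) • w := by rw [two_smul]; abel
  rw [hw, norm_smul, map_smul, InnerProductSpace.toDual_apply_apply, Real.norm_eq_abs,
    Real.norm_eq_abs, smul_eq_mul, abs_two] at h
  linarith

lemma toEuclideanLin_transpose_apply_eq_inner {n m : ℕ} (P : Matrix (Fin n) (Fin m) ℝ)
    (v : EuclideanSpace ℝ (Fin n)) (i : Fin m) :
    Matrix.toEuclideanLin Pᵀ v i =
      ⟪v, Matrix.toEuclideanLin P (EuclideanSpace.single i (1 : ℝ))⟫ := by
  simp [Matrix.toLpLin_apply, PiLp.inner_apply, Matrix.mulVec, dotProduct]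

/-- Each coordinate of `fdGrad` approximates that of the subspace gradient `Pᵀ∇f(x)` up to
`L * ε`. -/
lemma abs_fdGrad_apply_sub_le {n m : ℕ} {f : EuclideanSpace ℝ (Fin n) → ℝ} {L : ℝ} (hL : 0 ≤ L)
    (hf : Differentiable ℝ f)
    (hlip : ∀ u v : EuclideanSpace ℝ (Fin n), ‖gradient f u - gradient f v‖ ≤ L * ‖u - v‖)
    {P : Matrix (Fin n) (Fin m) ℝ} {i : Fin m}
    (hcol : ‖Matrix.toEuclideanLin P (EuclideanSpace.single i (1 : ℝ))‖ ≤ 1)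
    {ε : ℝ} (hε : 0 < ε) (x : EuclideanSpace ℝ (Fin n)) :
    |fdGrad f P ε x i - Matrix.toEuclideanLin Pᵀ (gradient f x) i| ≤ L * ε := by
  rw [toEuclideanLin_transpose_apply_eq_inner]
  change |(f (x + ε • Matrix.toEuclideanLin P (EuclideanSpace.single i (1 : ℝ))) -
      f (x - ε • Matrix.toEuclideanLin P (EuclideanSpace.single i (1 : ℝ)))) / (2 * ε) - _| ≤ _
  set v := Matrix.toEuclideanLin P (EuclideanSpace.single i (1 : ℝ))
  have h := abs_central_diff_sub_inner_gradient_le hL hf hlip x (ε • v)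
  rw [real_inner_smul_right, norm_smul, Real.norm_of_nonneg hε.le] at h
  have hdiv : (f (x + ε • v) - f (x - ε • v)) / (2 * ε) - ⟪gradient f x, v⟫ =
      (f (x + ε • v) - f (x - ε • v) - 2 * (ε * ⟪gradient f x, v⟫)) / (2 * ε) := by
    field_simp
  rw [hdiv, abs_div, abs_of_pos (by positivity : 0 < 2 * ε), div_le_iff₀ (by positivity)]
  have hv : (ε * ‖v‖) ^ 2 ≤ ε ^ 2 := by
    gcongr
    exact mul_le_of_le_one_right hε.le hcol
  calc _ ≤ 2 * L * (ε * ‖v‖) ^ 2 := h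
    _ ≤ 2 * L * ε ^ 2 := by gcongr
    _ = L * ε * (2 * ε) := by ring

lemma EuclideanSpace.norm_le_card_mul_of_abs_apply_le {m : ℕ} {u : EuclideanSpace ℝ (Fin m)}
    {C : ℝ} (hu : ∀ i, |u i| ≤ C) : ‖u‖ ≤ m * C := by
  have hsum : u = ∑ i, EuclideanSpace.single i (u i) := by
    ext j
    simp [Finset.sum_apply, Pi.single_apply]
  calc ‖u‖ = ‖∑ i, EuclideanSpace.single i (u i)‖ := by rw [← hsum]
    _ ≤ ∑ _i : Fin m, C := norm_sum_le_of_le _ fun i _ => by simpa using hu i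
    _ = m * C := by simp

lemma mul_norm_sq_le_inner_toEuclideanLin {m : ℕ} {H : Matrix (Fin m) (Fin m) ℝ} {M : ℝ}
    (hH : (H - M • (1 : Matrix (Fin m) (Fin m) ℝ)).PosSemidef) (v : EuclideanSpace ℝ (Fin m)) :
    M * ‖v‖ ^ 2 ≤ ⟪v, Matrix.toEuclideanLin H v⟫ := by
  have h := hH.dotProduct_mulVec_nonneg v.ofLp
  rw [Matrix.sub_mulVec, Matrix.smul_mulVec, Matrix.one_mulVec, dotProduct_sub,
    dotProduct_smul, star_trivial, smul_eq_mul] at h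
  have hnorm : v.ofLp ⬝ᵥ v.ofLp = ‖v‖ ^ 2 := by
    rw [EuclideanSpace.real_norm_sq_eq]
    simp [dotProduct, sq]
  have hinner : ⟪v, Matrix.toEuclideanLin H v⟫ = v.ofLp ⬝ᵥ H *ᵥ v.ofLp := by
    simp [EuclideanSpace.inner_eq_star_dotProduct, dotProduct_comm]
  rw [hinner, ← hnorm]
  linarith

/-- Let `f` be continuously differentiable with `L`-Lipschitz gradient, `P` with columns of norm at
most 1 and `ε > 0`. If `‖Pᵀ∇f(x)‖ ≥ 4 m² L ε` then `‖∇_{P,ε}f(x)‖ ≥ (1/2)‖Pᵀ∇f(x)‖`.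
Consequently, if `H` is symmetric with `M₁ I ⪯ H` (`M₁ > 0`), `d = -H ∇_{P,ε}f(x)`,
`c ∈ (0,1)`, `α > 0`, and the approximate Armijo condition holds, then
`f(x+αPd) - f(x) ≤ -(cαM₁/4)‖Pᵀ∇f(x)‖²`. -/
theorem stmt16 {n m : ℕ} (f : EuclideanSpace ℝ (Fin n) → ℝ)
    (L : ℝ) (hL : 0 < L) (hf : ContDiff ℝ 1 f)
    (hlip : ∀ u v : EuclideanSpace ℝ (Fin n),
      ‖gradient f u - gradient f v‖ ≤ L * ‖u - v‖)
    (P : Matrix (Fin n) (Fin m) ℝ)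
    (hcol : ∀ j : Fin m, ‖Matrix.toEuclideanLin P (EuclideanSpace.single j (1 : ℝ))‖ ≤ 1)
    (ε : ℝ) (hε : 0 < ε) (x : EuclideanSpace ℝ (Fin n))
    (hbig : 4 * (m : ℝ) ^ 2 * L * ε ≤ ‖Matrix.toEuclideanLin Pᵀ (gradient f x)‖) :
    (1 / 2) * ‖Matrix.toEuclideanLin Pᵀ (gradient f x)‖ ≤ ‖fdGrad f P ε x‖ ∧
      ∀ (H : Matrix (Fin m) (Fin m) ℝ) (M₁ c α : ℝ) (d : EuclideanSpace ℝ (Fin m)),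
        H.IsHermitian → 0 < M₁ →
        (H - M₁ • (1 : Matrix (Fin m) (Fin m) ℝ)).PosSemidef →
        c ∈ Set.Ioo (0 : ℝ) 1 → 0 < α →
        d = -(Matrix.toEuclideanLin H (fdGrad f P ε x)) →
        f (x + α • Matrix.toEuclideanLin P d) ≤ f x + c * α * ⟪fdGrad f P ε x, d⟫ →
        f (x + α • Matrix.toEuclideanLin P d) - f x ≤
          -(c * α * M₁ / 4) * ‖Matrix.toEuclideanLin Pᵀ (gradient f x)‖ ^ 2 := by
  have herr : ‖fdGrad f P ε x - Matrix.toEuclideanLin Pᵀ (gradient f x)‖ ≤ m * (L * ε) :=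
    EuclideanSpace.norm_le_card_mul_of_abs_apply_le fun i =>
      abs_fdGrad_apply_sub_le hL.le (hf.differentiable one_ne_zero) hlip (hcol i) hε x
  have hm : (m : ℝ) * (L * ε) ≤ (m : ℝ) ^ 2 * (L * ε) := by
    gcongr
    exact_mod_cast Nat.le_self_pow two_ne_zero m
  have htri := norm_sub_norm_le (Matrix.toEuclideanLin Pᵀ (gradient f x)) (fdGrad f P ε x)
  rw [norm_sub_rev] at htri
  have hhalf : (1 / 2) * ‖Matrix.toEuclideanLin Pᵀ (gradient f x)‖ ≤ ‖fdGrad f P ε x‖ := by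
    linarith [norm_nonneg (Matrix.toEuclideanLin Pᵀ (gradient f x))]
  refine ⟨hhalf, ?_⟩
  rintro H M₁ c α d - hM₁ hpsd ⟨hc, -⟩ hα hd harmijo
  have hcurv := mul_norm_sq_le_inner_toEuclideanLin hpsd (fdGrad f P ε x)
  have hinner : ⟪fdGrad f P ε x, d⟫ =
      -⟪fdGrad f P ε x, Matrix.toEuclideanLin H (fdGrad f P ε x)⟫ := by
    rw [hd, inner_neg_right]
  have hsq : ((1 / 2) * ‖Matrix.toEuclideanLin Pᵀ (gradient f x)‖) ^ 2 ≤
      ‖fdGrad f P ε x‖ ^ 2 := by gcongr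
  have hdecr := mul_le_mul_of_nonneg_left
    ((mul_le_mul_of_nonneg_left hsq hM₁.le).trans hcurv) (mul_pos hc hα).le
  rw [hinner] at harmijo
  linarith
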